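/- arXiv:math/0512414 — 5 statements merged into one kernel-verified Lean document; each statement's English description precedes it below -/
import Mathlib

section
/- The double integral ∫_{ℝ^d}∫_{ℝ^d} [1 / (‖y₁+y₂‖^α (‖y₁‖^α + ‖y₂‖^α + ‖y₁+y₂‖^α))] · [(1 - e^{-‖y₁‖^α})/‖y₁‖^α] · [(1 - e^{-‖y₂‖^α})/‖y₂‖^α] · [(1 - e^{-‖y₁+y₂‖^α})/‖y₁+y₂‖^α] dy₁ dy₂ is finite. -/
open MeasureTheory

noncomputable def phi5 (α r : ℝ) : ℝ := (r ^ α)⁻¹ * min 1 (r ^ α)⁻¹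

lemma phi5_nonneg (α r : ℝ) (hr : 0 ≤ r) : 0 ≤ phi5 α r := by
  unfold phi5
  have := Real.rpow_nonneg hr α
  positivity

lemma phi5_meas (α : ℝ) : Measurable (phi5 α) := by
  unfold phi5
  fun_prop

lemma phi5_int (d : ℕ) (hd : 0 < d) (α : ℝ)
    (h1 : α < d) (h2 : (d : ℝ) < 2 * α) :
    Integrable (fun x : EuclideanSpace ℝ (Fin d) => phi5 α ‖x‖) := by
  haveI : Nonempty (Fin d) := ⟨⟨0, hd⟩⟩
  rw [integrable_fun_norm_addHaar (μ := volume) (f := phi5 α)]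
  simp only [finrank_euclideanSpace, Fintype.card_fin]
  have hm : Measurable (fun y : ℝ => y ^ (d - 1) • phi5 α y) :=
    (measurable_id.pow_const _).smul (phi5_meas α)
  have hcast : ((d - 1 : ℕ) : ℝ) = d - 1 := by
    rw [Nat.cast_sub hd]; simp
  rw [← Set.Ioc_union_Ioi_eq_Ioi (zero_le_one' ℝ)]
  refine IntegrableOn.union ?_ ?_
  · have h : IntegrableOn (fun y : ℝ => y ^ ((d : ℝ) - 1 - α)) (Set.Ioc 0 1) := by
      have := intervalIntegral.intervalIntegrable_rpow' (a := 0) (b := 1)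
        (r := (d : ℝ) - 1 - α) (by linarith)
      rwa [intervalIntegrable_iff_integrableOn_Ioc_of_le zero_le_one] at this
    refine Integrable.mono' h hm.aestronglyMeasurable ?_
    filter_upwards [ae_restrict_mem measurableSet_Ioc] with y hy
    have hy0 : 0 < y := hy.1
    rw [Real.norm_of_nonneg (smul_nonneg (by positivity) (phi5_nonneg α y hy0.le)),
      Real.rpow_sub hy0, ← hcast, Real.rpow_natCast, smul_eq_mul, div_eq_mul_inv]
    have := Real.rpow_pos_of_pos hy0 α
    gcongr
    exact mul_le_of_le_one_right (by positivity) (min_le_left _ _)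
  · have h : IntegrableOn (fun y : ℝ => y ^ ((d : ℝ) - 1 - (α + α))) (Set.Ioi 1) :=
      integrableOn_Ioi_rpow_of_lt (by linarith) one_pos
    refine Integrable.mono' h hm.aestronglyMeasurable ?_
    filter_upwards [ae_restrict_mem measurableSet_Ioi] with y hy
    have hy0 : 0 < y := one_pos.trans hy
    rw [Real.norm_of_nonneg (smul_nonneg (by positivity) (phi5_nonneg α y hy0.le)),
      Real.rpow_sub hy0, ← hcast, Real.rpow_natCast, smul_eq_mul, div_eq_mul_inv,
      Real.rpow_add hy0, mul_inv]
    have := Real.rpow_pos_of_pos hy0 α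
    unfold phi5
    gcongr
    exact min_le_right _ _

lemma g5_nonneg (A : ℝ) (hA : 0 ≤ A) : 0 ≤ (1 - Real.exp (-A)) / A := by
  have : Real.exp (-A) ≤ 1 := Real.exp_le_one_iff.2 (by linarith)
  exact div_nonneg (by linarith) hA

lemma g5_le_one (A : ℝ) (hA : 0 ≤ A) : (1 - Real.exp (-A)) / A ≤ 1 := by
  have := Real.add_one_le_exp (-A)
  exact div_le_one_of_le₀ (by linarith) hA

lemma g5_le (A : ℝ) (hA : 0 ≤ A) : (1 - Real.exp (-A)) / A ≤ min 1 A⁻¹ := by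
  refine le_min (g5_le_one A hA) ?_
  rw [div_eq_mul_inv]
  exact mul_le_of_le_one_left (by positivity) (by linarith [Real.exp_pos (-A)])

lemma key5 (A B Z : ℝ) (hA : 0 ≤ A) (hB : 0 ≤ B) (hZ : 0 ≤ Z) :
    1 / (Z * (A + B + Z)) * ((1 - Real.exp (-A)) / A) * ((1 - Real.exp (-B)) / B) *
      ((1 - Real.exp (-Z)) / Z) ≤ (A⁻¹ * min 1 A⁻¹) * (Z⁻¹ * min 1 Z⁻¹) := by
  rcases hA.eq_or_lt with rfl | hA'
  · simp
  rcases hZ.eq_or_lt with rfl | hZ'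
  · simp
  have a1 := g5_nonneg A hA
  have b1 := g5_nonneg B hB
  have z1 := g5_nonneg Z hZ
  have a2 := g5_le A hA
  have b2 := g5_le_one B hB
  have z2 := g5_le Z hZ
  have h : 1 / (Z * (A + B + Z)) ≤ 1 / (Z * A) := by
    gcongr
    linarith
  calc _ ≤ 1 / (Z * A) * min 1 A⁻¹ * 1 * min 1 Z⁻¹ := by gcongr
    _ = _ := by rw [one_div, mul_inv]; ring

theorem stmt_5
    (d : ℕ) (hd : 0 < d) (α : ℝ) (hα : 0 < α)
    (h1 : α < d) (h2 : (d : ℝ) < 2 * α) :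
    ∫⁻ y₁ : EuclideanSpace ℝ (Fin d), ∫⁻ y₂ : EuclideanSpace ℝ (Fin d),
      ENNReal.ofReal
        (1 / (‖y₁ + y₂‖ ^ α * (‖y₁‖ ^ α + ‖y₂‖ ^ α + ‖y₁ + y₂‖ ^ α)) *
          ((1 - Real.exp (-‖y₁‖ ^ α)) / ‖y₁‖ ^ α) *
          ((1 - Real.exp (-‖y₂‖ ^ α)) / ‖y₂‖ ^ α) *
          ((1 - Real.exp (-‖y₁ + y₂‖ ^ α)) / ‖y₁ + y₂‖ ^ α)) < ⊤ := by
  have hint := phi5_int d hd α h1 h2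
  set F : EuclideanSpace ℝ (Fin d) → ENNReal := fun x => ENNReal.ofReal (phi5 α ‖x‖) with hF
  have hFm : Measurable F := ((phi5_meas α).comp measurable_norm).ennreal_ofReal
  have hfin : ∫⁻ x, F x < ⊤ := hint.lintegral_lt_top
  calc _ ≤ ∫⁻ y₁, ∫⁻ y₂, F y₁ * F (y₁ + y₂) := by
        refine lintegral_mono fun y₁ => lintegral_mono fun y₂ => ?_
        simp only [hF]
        rw [← ENNReal.ofReal_mul (phi5_nonneg _ _ (norm_nonneg _))]
        exact ENNReal.ofReal_le_ofReal (key5 _ _ _ (by positivity) (by positivity) (by positivity))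
    _ = ∫⁻ y₁, F y₁ * ∫⁻ x, F x := by
        refine lintegral_congr fun y₁ => ?_
        rw [lintegral_const_mul _ (by fun_prop), lintegral_add_left_eq_self F y₁]
    _ = (∫⁻ x, F x) * ∫⁻ x, F x := lintegral_mul_const _ hFm
    _ < ⊤ := ENNReal.mul_lt_top hfin hfin
end

section
/- There exists a constant c such that for every x ∈ ℝ^d, ∫_{ℝ^d} [1 / (‖x‖^α + ‖z‖^α + ‖x-z‖^α)] · [(1 - e^{-‖z‖^α})/‖z‖^α] · [(1 - e^{-‖x-z‖^α})/‖x-z‖^α] dz ≤ c. -/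
open MeasureTheory

lemma aux_g (A : ℝ) (hA : 0 ≤ A) :
    0 ≤ (1 - Real.exp (-A)) / A ∧ (1 - Real.exp (-A)) / A ≤ min 1 A⁻¹ := by
  have h1 : Real.exp (-A) ≤ 1 := Real.exp_le_one_iff.2 (by linarith)
  have h2 := Real.add_one_le_exp (-A)
  have h3 := Real.exp_pos (-A)
  refine ⟨div_nonneg (by linarith) hA, ?_⟩
  rcases hA.eq_or_lt with h | h
  · subst h; simp
  · refine le_min ?_ ?_
    · rw [div_le_one h]; linarith
    · rw [div_eq_mul_inv]
      have := inv_pos.2 h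
      nlinarith

lemma aux_pt (X A B : ℝ) (hX : 0 ≤ X) (hA : 0 ≤ A) (hAB : A ≤ B) :
    1 / (X + A + B) * ((1 - Real.exp (-A)) / A) * ((1 - Real.exp (-B)) / B)
      ≤ A⁻¹ * min 1 A⁻¹ := by
  rcases hA.eq_or_lt with h | h
  · subst h; simp
  obtain ⟨a1, a2⟩ := aux_g A hA
  obtain ⟨b1, b2⟩ := aux_g B (hA.trans hAB)
  have b3 : (1 - Real.exp (-B)) / B ≤ 1 := b2.trans (min_le_left _ _)
  have hm : 0 ≤ min 1 A⁻¹ := a1.trans a2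
  have hx : 1 / (X + A + B) ≤ A⁻¹ := by
    rw [one_div]; exact inv_anti₀ h (by linarith)
  have hA' := inv_pos.2 h
  calc _ ≤ A⁻¹ * min 1 A⁻¹ * 1 := by gcongr
    _ = _ := mul_one _

lemma aux_int (d : ℕ) (hd : 0 < d) (α : ℝ) (hα : 0 < α)
    (h1 : α < d) (h2 : (d : ℝ) < 2 * α) :
    Integrable (fun z : EuclideanSpace ℝ (Fin d) => (‖z‖ ^ α)⁻¹ * min 1 (‖z‖ ^ α)⁻¹) := by
  have : Nonempty (Fin d) := ⟨⟨0, hd⟩⟩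
  have key := integrable_fun_norm_addHaar (volume : Measure (EuclideanSpace ℝ (Fin d)))
    (f := fun t : ℝ => (t ^ α)⁻¹ * min 1 (t ^ α)⁻¹)
  refine key.2 ?_
  have hfin : Module.finrank ℝ (EuclideanSpace ℝ (Fin d)) = d := by simp
  rw [hfin]
  have hpow : ∀ t : ℝ, 0 < t → t ^ (d - 1) = t ^ ((d : ℝ) - 1) := by
    intro t ht
    rw [← Real.rpow_natCast, Nat.cast_sub hd]; simp
  have hmeas : Measurable (fun t : ℝ => t ^ (d - 1) • ((t ^ α)⁻¹ * min 1 (t ^ α)⁻¹)) := by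
    fun_prop
  rw [← Set.Ioc_union_Ioi_eq_Ioi (zero_le_one' ℝ)]
  refine IntegrableOn.union ?_ ?_
  · have : IntegrableOn (fun t : ℝ => t ^ ((d : ℝ) - 1 - α)) (Set.Ioc 0 1) := by
      rw [← intervalIntegrable_iff_integrableOn_Ioc_of_le zero_le_one]
      exact intervalIntegral.intervalIntegrable_rpow' (by linarith)
    refine Integrable.mono' this hmeas.aestronglyMeasurable ?_
    refine (ae_restrict_iff' measurableSet_Ioc).2 (Filter.Eventually.of_forall fun t ht => ?_)
    have hp := Real.rpow_pos_of_pos ht.1 α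
    have hq := Real.rpow_pos_of_pos ht.1 ((d : ℝ) - 1)
    rw [Real.norm_of_nonneg (by have := ht.1; positivity), smul_eq_mul, hpow t ht.1,
      Real.rpow_sub ht.1 _ α, div_eq_mul_inv]
    have hm : min 1 (t ^ α)⁻¹ ≤ 1 := min_le_left _ _
    calc _ ≤ t ^ ((d : ℝ) - 1) * ((t ^ α)⁻¹ * 1) := by gcongr
      _ = _ := by rw [mul_one]
  · have : IntegrableOn (fun t : ℝ => t ^ ((d : ℝ) - 1 - α - α)) (Set.Ioi 1) :=
      integrableOn_Ioi_rpow_of_lt (by linarith) one_pos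
    refine Integrable.mono' this hmeas.aestronglyMeasurable ?_
    refine (ae_restrict_iff' measurableSet_Ioi).2 (Filter.Eventually.of_forall fun t ht => ?_)
    have ht0 : 0 < t := one_pos.trans ht
    have hp := Real.rpow_pos_of_pos ht0 α
    have hq := Real.rpow_pos_of_pos ht0 ((d : ℝ) - 1)
    rw [Real.norm_of_nonneg (by positivity), smul_eq_mul, hpow t ht0,
      Real.rpow_sub ht0 _ α, Real.rpow_sub ht0 _ α, div_eq_mul_inv, div_eq_mul_inv, mul_assoc]
    have hm : min 1 (t ^ α)⁻¹ ≤ (t ^ α)⁻¹ := min_le_right _ _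
    exact mul_le_mul_of_nonneg_left (mul_le_mul_of_nonneg_left hm (by positivity)) hq.le

/-- For `α < d < 2α`, there is a constant `c` such that for every `x ∈ ℝ^d`,
`∫ [1/(‖x‖^α+‖z‖^α+‖x-z‖^α)] ⬝ [(1-e^{-‖z‖^α})/‖z‖^α] ⬝ [(1-e^{-‖x-z‖^α})/‖x-z‖^α] dz ≤ c`. -/
theorem stmt_6
    (d : ℕ) (hd : 0 < d) (α : ℝ) (hα : 0 < α)
    (h1 : α < d) (h2 : (d : ℝ) < 2 * α) :
    ∃ c : ℝ, ∀ x : EuclideanSpace ℝ (Fin d),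
      ∫⁻ z : EuclideanSpace ℝ (Fin d),
        ENNReal.ofReal
          (1 / (‖x‖ ^ α + ‖z‖ ^ α + ‖x - z‖ ^ α) *
            ((1 - Real.exp (-‖z‖ ^ α)) / ‖z‖ ^ α) *
            ((1 - Real.exp (-‖x - z‖ ^ α)) / ‖x - z‖ ^ α)) ≤ ENNReal.ofReal c := by
  have hI := aux_int d hd α hα h1 h2
  set h : EuclideanSpace ℝ (Fin d) → ℝ := fun z => (‖z‖ ^ α)⁻¹ * min 1 (‖z‖ ^ α)⁻¹ with hh
  have h0 : ∀ z, 0 ≤ h z := fun z => by simp only [hh]; positivity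
  refine ⟨(∫ z, h z) + ∫ z, h z, fun x => ?_⟩
  have hIx : Integrable (fun z => h (x - z)) := hI.comp_sub_left x
  have e : (∫ z, h z) + ∫ z, h z = ∫ z, (h z + h (x - z)) := by
    rw [integral_add hI hIx, integral_sub_left_eq_self h]
  rw [e, ofReal_integral_eq_lintegral_ofReal
    (f := fun z => h z + h (x - z)) (hI.add hIx)
    (Filter.Eventually.of_forall fun z => add_nonneg (h0 _) (h0 _))]
  refine lintegral_mono fun z => ENNReal.ofReal_le_ofReal ?_
  have hX : 0 ≤ ‖x‖ ^ α := by positivity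
  have hA : 0 ≤ ‖z‖ ^ α := by positivity
  have hB : 0 ≤ ‖x - z‖ ^ α := by positivity
  rcases le_total (‖z‖ ^ α) (‖x - z‖ ^ α) with hle | hle
  · exact (aux_pt _ _ _ hX hA hle).trans (le_add_of_nonneg_right (h0 _))
  · have := (aux_pt _ _ _ hX hB hle).trans (le_add_of_nonneg_left (h0 z))
    refine le_trans (le_of_eq ?_) this
    rw [add_right_comm]; ring
end

section
/- The function y ↦ (1 - e^{-‖y‖^α})² / ‖y‖^{3α} is Lebesgue-integrable on ℝ^d. -/
open MeasureTheory

/-- For `α < d < 2α`, the function `y ↦ (1-e^{-‖y‖^α})² / ‖y‖^{3α}`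
is Lebesgue-integrable on `ℝ^d`. -/
theorem stmt_8
    (d : ℕ) (hd : 0 < d) (α : ℝ) (hα : 0 < α)
    (h1 : α < d) (h2 : (d : ℝ) < 2 * α) :
    Integrable (fun y : EuclideanSpace ℝ (Fin d) =>
      (1 - Real.exp (-‖y‖ ^ α)) ^ 2 / ‖y‖ ^ (3 * α)) := by
  have : Nonempty (Fin d) := ⟨⟨0, hd⟩⟩
  have : Nontrivial (EuclideanSpace ℝ (Fin d)) := inferInstance
  refine (integrable_fun_norm_addHaar (E := EuclideanSpace ℝ (Fin d)) volume
    (f := fun r : ℝ => (1 - Real.exp (-r ^ α)) ^ 2 / r ^ (3 * α))).2 ?_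
  have hfin : Module.finrank ℝ (EuclideanSpace ℝ (Fin d)) = d := by simp
  rw [hfin]
  have hm : Measurable (fun r : ℝ => r ^ (d - 1) • ((1 - Real.exp (-r ^ α)) ^ 2 / r ^ (3 * α))) := by
    simp only [smul_eq_mul]
    fun_prop
  have hpow : ∀ r : ℝ, 0 < r → r ^ (d - 1) = r ^ ((d : ℝ) - 1) := by
    intro r hr
    rw [← Real.rpow_natCast, Nat.cast_sub hd, Nat.cast_one]
  rw [← Set.Ioc_union_Ioi_eq_Ioi (zero_le_one (α := ℝ))]
  refine IntegrableOn.union ?_ ?_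
  · have hi : IntegrableOn (fun r : ℝ => r ^ ((d : ℝ) - 1 - α)) (Set.Ioc 0 1) :=
      (intervalIntegrable_iff_integrableOn_Ioc_of_le zero_le_one).1
        (intervalIntegral.intervalIntegrable_rpow' (by linarith))
    refine Integrable.mono' hi hm.aestronglyMeasurable ?_
    refine (ae_restrict_iff' measurableSet_Ioc).2 (Filter.Eventually.of_forall fun r hr => ?_)
    have hr0 : 0 < r := hr.1
    have hp := Real.rpow_pos_of_pos hr0 α
    have e1 : Real.exp (-r ^ α) ≤ 1 := Real.exp_le_one_iff.2 (by linarith)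
    have e2 := Real.add_one_le_exp (-r ^ α)
    have e3 : (1 - Real.exp (-r ^ α)) ^ 2 ≤ r ^ (2 * α) := by
      rw [mul_comm, Real.rpow_mul hr0.le, Real.rpow_two]
      exact pow_le_pow_left₀ (by linarith) (by linarith) 2
    rw [Real.norm_of_nonneg (by simp only [smul_eq_mul]; positivity), smul_eq_mul, hpow r hr0]
    calc _ ≤ r ^ ((d : ℝ) - 1) * (r ^ (2 * α) / r ^ (3 * α)) := by gcongr
      _ = _ := by
        rw [← Real.rpow_sub hr0, ← Real.rpow_add hr0]; congr 1; ring
  · have hi : IntegrableOn (fun r : ℝ => r ^ ((d : ℝ) - 1 - 3 * α)) (Set.Ioi 1) :=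
      integrableOn_Ioi_rpow_of_lt (by linarith) one_pos
    refine Integrable.mono' hi hm.aestronglyMeasurable ?_
    refine (ae_restrict_iff' measurableSet_Ioi).2 (Filter.Eventually.of_forall fun r hr => ?_)
    have hr0 : 0 < r := lt_trans one_pos hr
    have hp := Real.rpow_pos_of_pos hr0 α
    have e1 : Real.exp (-r ^ α) ≤ 1 := Real.exp_le_one_iff.2 (by linarith)
    have e2 := Real.exp_pos (-r ^ α)
    have e3 : (1 - Real.exp (-r ^ α)) ^ 2 ≤ 1 :=
      pow_le_one₀ (by linarith) (by linarith)
    rw [Real.norm_of_nonneg (by simp only [smul_eq_mul]; positivity), smul_eq_mul, hpow r hr0]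
    calc _ ≤ r ^ ((d : ℝ) - 1) * (1 / r ^ (3 * α)) := by gcongr
      _ = _ := by
        rw [Real.rpow_sub hr0 _ (3 * α)]; ring
end

section
/- There exists a constant C such that for every u > 0 and every z ∈ ℝ^d, ∫_{ℝ^d} [(1 - e^{-u‖x‖^α})/‖x‖^α] · [(1 - e^{-u‖z-x‖^α})/‖z-x‖^α] dx ≤ C · u^{2 - d/α}. -/
open MeasureTheory

lemma aux_bound (α : ℝ) (hα : 0 < α) (r : ℝ) (hr : 0 ≤ r) :
    0 ≤ (1 - Real.exp (-(r ^ α))) / r ^ α ∧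
    (1 - Real.exp (-(r ^ α))) / r ^ α ≤ 2 ^ α * (1 + r) ^ (-α) := by
  have hrα : 0 ≤ r ^ α := Real.rpow_nonneg hr α
  have he1 : Real.exp (-(r ^ α)) ≤ 1 := Real.exp_le_one_iff.2 (by linarith)
  have he2 := Real.add_one_le_exp (-(r ^ α))
  have he0 := Real.exp_pos (-(r ^ α))
  refine ⟨div_nonneg (by linarith) hrα, ?_⟩
  have hp : (0:ℝ) < (1 + r) ^ α := Real.rpow_pos_of_pos (by linarith) α
  rw [Real.rpow_neg (by linarith), ← div_eq_mul_inv, le_div_iff₀ hp]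
  rcases le_total r 1 with h | h
  · have ha : (1 + r) ^ α ≤ 2 ^ α := Real.rpow_le_rpow (by linarith) (by linarith) hα.le
    have hb : (1 - Real.exp (-(r ^ α))) / r ^ α ≤ 1 :=
      div_le_one_of_le₀ (by linarith) hrα
    calc _ ≤ 1 * (1 + r) ^ α := by gcongr
      _ ≤ _ := by linarith
  · have hpos : 0 < r ^ α := Real.rpow_pos_of_pos (by linarith) α
    have ha : (1 + r) ^ α ≤ 2 ^ α * r ^ α := by
      rw [← Real.mul_rpow (by norm_num) hr]
      exact Real.rpow_le_rpow (by linarith) (by linarith) hα.le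
    rw [div_mul_eq_mul_div, div_le_iff₀ hpos]
    nlinarith

lemma aux_fin (d : ℕ) (α : ℝ) (hα : 0 < α) (h2 : (d : ℝ) < 2 * α) :
    ∫⁻ x : EuclideanSpace ℝ (Fin d),
      ENNReal.ofReal (((1 - Real.exp (-(‖x‖ ^ α))) / ‖x‖ ^ α) ^ 2) < ⊤ := by
  have hfin := finite_integral_one_add_norm (E := EuclideanSpace ℝ (Fin d)) (μ := volume)
    (r := 2 * α) (by simpa using h2)
  refine lt_of_le_of_lt (lintegral_mono (g := fun x => ENNReal.ofReal ((2 ^ α) ^ 2) *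
    ENNReal.ofReal ((1 + ‖x‖) ^ (-(2 * α)))) ?_) ?_
  · intro x
    dsimp only
    rw [← ENNReal.ofReal_mul (by positivity)]
    apply ENNReal.ofReal_le_ofReal
    obtain ⟨ha, hb⟩ := aux_bound α hα ‖x‖ (norm_nonneg x)
    have : (1 + ‖x‖) ^ (-(2 * α)) = ((1 + ‖x‖) ^ (-α)) ^ 2 := by
      rw [← Real.rpow_natCast, ← Real.rpow_mul (by positivity)]
      congr 1; push_cast; ring
    rw [this, ← mul_pow]
    gcongr
  · rw [lintegral_const_mul' _ _ ENNReal.ofReal_ne_top]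
    exact ENNReal.mul_lt_top ENNReal.ofReal_lt_top hfin

lemma aux_scale (d : ℕ) (α : ℝ) (hα : 0 < α) (u : ℝ) (hu : 0 < u) :
    ∫⁻ x : EuclideanSpace ℝ (Fin d),
      ENNReal.ofReal (((1 - Real.exp (-(u * ‖x‖ ^ α))) / ‖x‖ ^ α) ^ 2) =
    ENNReal.ofReal (u ^ (2 - (d : ℝ) / α)) * ∫⁻ x : EuclideanSpace ℝ (Fin d),
      ENNReal.ofReal (((1 - Real.exp (-(‖x‖ ^ α))) / ‖x‖ ^ α) ^ 2) := by
  set R : ℝ := u ^ (1 / α) with hR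
  have hR0 : 0 < R := Real.rpow_pos_of_pos hu _
  have hRα : R ^ α = u := by
    rw [hR, ← Real.rpow_mul hu.le]; simp [hα.ne']
  have hm := Measure.map_addHaar_smul (volume : Measure (EuclideanSpace ℝ (Fin d))) hR0.ne'
  have hmeas : Measurable fun x : EuclideanSpace ℝ (Fin d) =>
      ENNReal.ofReal (((1 - Real.exp (-(‖x‖ ^ α))) / ‖x‖ ^ α) ^ 2) := by fun_prop
  have h3 := lintegral_map (μ := (volume : Measure (EuclideanSpace ℝ (Fin d)))) hmeas
    (measurable_const_smul R)
  have hm' : Measure.map (fun x : EuclideanSpace ℝ (Fin d) => R • x) volume = _ := hm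
  rw [hm', lintegral_smul_measure] at h3
  have h4 : ∀ x : EuclideanSpace ℝ (Fin d),
      ENNReal.ofReal (((1 - Real.exp (-(u * ‖x‖ ^ α))) / ‖x‖ ^ α) ^ 2) =
      ENNReal.ofReal (u ^ 2) *
      ENNReal.ofReal (((1 - Real.exp (-(‖R • x‖ ^ α))) / ‖R • x‖ ^ α) ^ 2) := by
    intro x
    rw [← ENNReal.ofReal_mul (by positivity), ← mul_pow, norm_smul, Real.norm_of_nonneg hR0.le,
      Real.mul_rpow hR0.le (norm_nonneg _), hRα]
    congr 2
    rw [mul_div_assoc', mul_div_mul_left _ _ hu.ne']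
  simp_rw [h4]
  rw [lintegral_const_mul' _ _ ENNReal.ofReal_ne_top, ← h3, smul_eq_mul, ← mul_assoc,
    ← ENNReal.ofReal_mul (by positivity)]
  congr 2
  rw [abs_of_pos (by positivity), finrank_euclideanSpace_fin, hR, ← Real.rpow_natCast (u ^ (1 / α)),
    ← Real.rpow_mul hu.le, Real.rpow_sub hu, div_eq_mul_inv (u ^ (2:ℝ)),
    Real.rpow_two, one_div_mul_eq_div]

theorem stmt_10
    (d : ℕ) (hd : 0 < d) (α : ℝ) (hα : 0 < α)
    (h1 : α < d) (h2 : (d : ℝ) < 2 * α) :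
    ∃ C : ℝ, ∀ u : ℝ, 0 < u → ∀ z : EuclideanSpace ℝ (Fin d),
      ∫⁻ x : EuclideanSpace ℝ (Fin d),
        ENNReal.ofReal
          (((1 - Real.exp (-(u * ‖x‖ ^ α))) / ‖x‖ ^ α) *
            ((1 - Real.exp (-(u * ‖z - x‖ ^ α))) / ‖z - x‖ ^ α)) ≤
        ENNReal.ofReal (C * u ^ (2 - (d : ℝ) / α)) := by
  have hfin := aux_fin d α hα h2
  set I := ∫⁻ x : EuclideanSpace ℝ (Fin d),
      ENNReal.ofReal (((1 - Real.exp (-(‖x‖ ^ α))) / ‖x‖ ^ α) ^ 2) with hI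
  refine ⟨2 * I.toReal, fun u hu z => ?_⟩
  have hs := aux_scale d α hα u hu
  rw [← hI] at hs
  let F : EuclideanSpace ℝ (Fin d) → ENNReal := fun x =>
    ENNReal.ofReal (((1 - Real.exp (-(u * ‖x‖ ^ α))) / ‖x‖ ^ α) ^ 2)
  have hF : Measurable F := by fun_prop
  have ht : ∫⁻ x, F (z - x) = ∫⁻ x, F x := lintegral_sub_left_eq_self F z
  calc _ ≤ ∫⁻ x, (F x + F (z - x)) := by
        refine lintegral_mono fun x => ?_
        dsimp only [F]
        rw [← ENNReal.ofReal_add (by positivity) (by positivity)]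
        apply ENNReal.ofReal_le_ofReal
        generalize (1 - Real.exp (-(u * ‖x‖ ^ α))) / ‖x‖ ^ α = a
        generalize (1 - Real.exp (-(u * ‖z - x‖ ^ α))) / ‖z - x‖ ^ α = b
        nlinarith [sq_nonneg (a - b), sq_nonneg a, sq_nonneg b]
    _ = 2 * (ENNReal.ofReal (u ^ (2 - (d : ℝ) / α)) * I) := by
        rw [lintegral_add_left hF, ht, ← hs, two_mul]
    _ = _ := by
        rw [mul_right_comm, ENNReal.ofReal_mul (by positivity), ENNReal.ofReal_mul (by positivity),
          ENNReal.ofReal_toReal hfin.ne, ENNReal.ofReal_ofNat, mul_assoc]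
end

section
/- Let h ∈ (1,2), let ψ : [0,1] → ℝ be continuous, and set χ(u) = ∫_u^1 ψ(s) ds. Then h(h-1) · ∫₀¹∫₀¹ (u₁+u₂)^{h-2} χ(u₁) χ(u₂) du₁ du₂ = ∫₀¹∫₀¹ [ (u₁+u₂)^h − u₁^h − u₂^h ] ψ(u₁) ψ(u₂) du₁ du₂. -/
open MeasureTheory

theorem aux_cont
    (h : ℝ) (hh1 : 1 < h)
    (ψ : ℝ → ℝ) (hψ : Continuous ψ)
    (χ : ℝ → ℝ) (hχ : ∀ u, χ u = ∫ s in u..(1 : ℝ), ψ s) :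
    h * (h - 1) *
        ∫ u₁ in (0 : ℝ)..1, ∫ u₂ in (0 : ℝ)..1, (u₁ + u₂) ^ (h - 2) * χ u₁ * χ u₂ =
      ∫ u₁ in (0 : ℝ)..1, ∫ u₂ in (0 : ℝ)..1,
        ((u₁ + u₂) ^ h - u₁ ^ h - u₂ ^ h) * ψ u₁ * ψ u₂ := by
  have hd : ∀ u, HasDerivAt χ (-ψ u) u := by
    intro u
    have : χ = fun u => ∫ s in u..(1 : ℝ), ψ s := funext hχ
    rw [this]
    exact intervalIntegral.integral_hasDerivAt_left (hψ.intervalIntegrable _ _)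
      (hψ.stronglyMeasurableAtFilter _ _) hψ.continuousAt
  have hχc : Continuous χ := continuous_iff_continuousAt.2 fun u => (hd u).continuousAt
  have hχ1 : χ 1 = 0 := by simp [hχ]
  have h1 : ∀ x : ℝ, 0 < x → (h - 1) * ∫ y in (0:ℝ)..1, (x + y) ^ (h - 2) * χ x * χ y
      = ∫ y in (0:ℝ)..1, ((x + y) ^ (h - 1) - x ^ (h - 1)) * χ x * ψ y := by
    intro x hx
    have key := intervalIntegral.integral_mul_deriv_eq_deriv_mul (a := 0) (b := 1)
      (u := χ) (u' := fun y => -ψ y) (v := fun y => ((x + y) ^ (h - 1) - x ^ (h - 1)))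
      (v' := fun y => (h - 1) * (x + y) ^ (h - 2)) (fun y _ => hd y)
      (by
        intro y hy
        rw [Set.uIcc_of_le zero_le_one] at hy
        have := (((hasDerivAt_id y).const_add x).rpow_const (p := h - 1)
          (Or.inl (by simp only [id]; linarith [hy.1]))).sub_const (x ^ (h - 1))
        refine HasDerivAt.congr_deriv this ?_
        simp only [id]; rw [show h - 1 - 1 = h - 2 by ring]; ring)
      (hψ.neg.intervalIntegrable _ _)
      (by
        apply ContinuousOn.intervalIntegrable
        intro y hy
        rw [Set.uIcc_of_le zero_le_one] at hy
        apply ContinuousAt.continuousWithinAt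
        apply ContinuousAt.mul continuousAt_const
        exact ContinuousAt.rpow_const (by fun_prop) (Or.inl (by linarith [hy.1])))
    simp only [hχ1, add_zero, sub_self, mul_zero, zero_mul, zero_sub] at key
    rw [← intervalIntegral.integral_neg] at key
    have key2 := congrArg (fun t => χ x * t) key
    simp only [← intervalIntegral.integral_const_mul] at key2
    rw [← intervalIntegral.integral_const_mul]
    refine Eq.trans ?_ (key2.trans ?_) <;>
    · apply intervalIntegral.integral_congr
      intro t _
      ring
  have h2 : ∀ y : ℝ, 0 ≤ y → h * ∫ x in (0:ℝ)..1, ((x + y) ^ (h - 1) - x ^ (h - 1)) * χ x * ψ y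
      = ∫ x in (0:ℝ)..1, ((y + x) ^ h - y ^ h - x ^ h) * ψ y * ψ x := by
    intro y hy
    have key := intervalIntegral.integral_mul_deriv_eq_deriv_mul (a := 0) (b := 1)
      (u := χ) (u' := fun y => -ψ y) (v := fun x => ((y + x) ^ h - y ^ h - x ^ h))
      (v' := fun x => h * (x + y) ^ (h - 1) - h * x ^ (h - 1)) (fun y _ => hd y)
      (by
        intro x hx
        have := ((((hasDerivAt_id x).const_add y).rpow_const (p := h)
          (Or.inr hh1.le)).sub_const (y ^ h)).sub
          ((hasDerivAt_id x).rpow_const (p := h) (Or.inr hh1.le))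
        refine HasDerivAt.congr_deriv this ?_
        simp only [id]; rw [add_comm x y]; ring)
      (hψ.neg.intervalIntegrable _ _)
      (by
        apply Continuous.intervalIntegrable
        have : 0 ≤ h - 1 := by linarith
        fun_prop (disch := assumption))
    simp only [hχ1, add_zero, sub_self, mul_zero, zero_mul, zero_sub,
      Real.zero_rpow (show h ≠ 0 by linarith)] at key
    rw [← intervalIntegral.integral_neg] at key
    have key2 := congrArg (fun t => ψ y * t) key
    simp only [← intervalIntegral.integral_const_mul] at key2
    rw [← intervalIntegral.integral_const_mul]
    refine Eq.trans ?_ (key2.trans ?_) <;>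
    · apply intervalIntegral.integral_congr
      intro t _
      ring
  have e1 : (h - 1) * ∫ u₁ in (0 : ℝ)..1, ∫ u₂ in (0 : ℝ)..1, (u₁ + u₂) ^ (h - 2) * χ u₁ * χ u₂
      = ∫ x in (0:ℝ)..1, ∫ y in (0:ℝ)..1, ((x + y) ^ (h - 1) - x ^ (h - 1)) * χ x * ψ y := by
    rw [← intervalIntegral.integral_const_mul]
    apply intervalIntegral.integral_congr_ae
    refine Filter.Eventually.of_forall fun x hx => ?_
    rw [Set.uIoc_of_le zero_le_one] at hx
    exact h1 x hx.1
  rw [mul_assoc, e1, intervalIntegral_intervalIntegral_swap, ← intervalIntegral.integral_const_mul]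
  · apply intervalIntegral.integral_congr
    intro y hy
    rw [Set.uIcc_of_le zero_le_one] at hy
    exact h2 y hy.1
  · have hp : 0 ≤ h - 1 := by linarith
    have hF : Continuous (Function.uncurry fun x y : ℝ =>
        ((x + y) ^ (h - 1) - x ^ (h - 1)) * χ x * ψ y) := by
      simp only [Function.uncurry_def]
      fun_prop (disch := assumption)
    refine (hF.continuousOn.integrableOn_compact
      (isCompact_Icc.prod isCompact_Icc : IsCompact (Set.Icc (0:ℝ) 1 ×ˢ Set.Icc (0:ℝ) 1))).mono_set ?_
    rw [Set.uIoc_of_le zero_le_one]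
    exact Set.prod_mono Set.Ioc_subset_Icc_self Set.Ioc_subset_Icc_self

theorem stmt_12
    (h : ℝ) (hh1 : 1 < h) (hh2 : h < 2)
    (ψ : ℝ → ℝ) (hψ : ContinuousOn ψ (Set.Icc 0 1))
    (χ : ℝ → ℝ) (hχ : ∀ u, χ u = ∫ s in u..(1 : ℝ), ψ s) :
    h * (h - 1) *
        ∫ u₁ in (0 : ℝ)..1, ∫ u₂ in (0 : ℝ)..1, (u₁ + u₂) ^ (h - 2) * χ u₁ * χ u₂ =
      ∫ u₁ in (0 : ℝ)..1, ∫ u₂ in (0 : ℝ)..1,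
        ((u₁ + u₂) ^ h - u₁ ^ h - u₂ ^ h) * ψ u₁ * ψ u₂ := by
  have hc : Continuous (Set.IccExtend (zero_le_one' ℝ) ((Set.Icc (0:ℝ) 1).domRestrict ψ)) :=
    (continuousOn_iff_continuous_domRestrict.1 hψ).Icc_extend'
  set φ := Set.IccExtend (zero_le_one' ℝ) ((Set.Icc (0:ℝ) 1).domRestrict ψ) with hφ
  have hφe : ∀ x ∈ Set.Icc (0:ℝ) 1, φ x = ψ x := fun x hx => by
    rw [hφ, Set.IccExtend_of_mem _ _ hx]; rfl
  have hχe : ∀ x ∈ Set.Icc (0:ℝ) 1, (∫ s in x..(1:ℝ), φ s) = χ x := fun x hx => by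
    rw [hχ]
    apply intervalIntegral.integral_congr
    intro s hs
    rw [Set.uIcc_of_le hx.2] at hs
    exact hφe s ⟨hx.1.trans hs.1, hs.2⟩
  have := aux_cont h hh1 φ hc (fun u => ∫ s in u..(1:ℝ), φ s) (fun _ => rfl)
  refine Eq.trans (congrArg (fun t => h * (h - 1) * t) ?_) (this.trans ?_)
  · apply intervalIntegral.integral_congr
    intro x hx
    apply intervalIntegral.integral_congr
    intro y hy
    rw [Set.uIcc_of_le zero_le_one] at hx hy
    simp only [hχe x hx, hχe y hy]
  · apply intervalIntegral.integral_congr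
    intro x hx
    apply intervalIntegral.integral_congr
    intro y hy
    rw [Set.uIcc_of_le zero_le_one] at hx hy
    simp only [hφe x hx, hφe y hy]
end
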